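/- Every nonempty exponential set V ⊆ ℝⁿ over 𝕂 can be represented as a finite union V = V₁ ∪ ⋯ ∪ V_t of irreducible exponential sets over 𝕂; if in addition V_i ⊄ V_j for all i ≠ j, then the collection of sets {V₁,…,V_t} is uniquely determined by V (these are the irreducible components of V). -/

import Mathlib

open MeasureTheory Set
open scoped ENNReal

noncomputable section

/-- `K` is a real algebraic extension of `ℚ`: every element of `K` is algebraic over `ℚ`. -/
def RealAlgExt (K : Subfield ℝ) : Prop := ∀ a : K, IsAlgebraic ℚ (a : ℝ)

/-- A real polynomial has all its coefficients in the subfield `K` of `ℝ`. -/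
def CoeffsIn {σ : Type*} (K : Subfield ℝ) (P : MvPolynomial σ ℝ) : Prop :=
  ∀ m, P.coeff m ∈ K

/-- Evaluation of a polynomial in `X₁,…,Xₙ,U₁,…,Uₙ` at `(x, e^x)`:
the E-polynomial associated to `P`. -/
def expEval {n : ℕ} (P : MvPolynomial (Fin n ⊕ Fin n) ℝ) (x : Fin n → ℝ) : ℝ :=
  MvPolynomial.eval (Sum.elim x fun i => Real.exp (x i)) P

/-- Exponential sets over `K` in `ℝⁿ`: zero sets of E-polynomials over `K`. -/
def IsExpSet {n : ℕ} (K : Subfield ℝ) (V : Set (Fin n → ℝ)) : Prop :=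
  ∃ P : MvPolynomial (Fin n ⊕ Fin n) ℝ, CoeffsIn K P ∧ V = {x | expEval P x = 0}

/-- Real algebraic sets over `K` (in coordinates indexed by `σ`). -/
def IsAlgSet {σ : Type*} (K : Subfield ℝ) (S : Set (σ → ℝ)) : Prop :=
  ∃ P : MvPolynomial σ ℝ, CoeffsIn K P ∧ S = {x | MvPolynomial.eval x P = 0}

/-- An exponential set is irreducible if it is nonempty and is not the union of
two proper exponential subsets. -/
def IsIrredExpSet {n : ℕ} (K : Subfield ℝ) (V : Set (Fin n → ℝ)) : Prop :=
  IsExpSet K V ∧ V.Nonempty ∧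
    ¬ ∃ V₁ V₂ : Set (Fin n → ℝ),
      IsExpSet K V₁ ∧ IsExpSet K V₂ ∧ V = V₁ ∪ V₂ ∧ V₁ ⊂ V ∧ V₂ ⊂ V

/-- `T` is an irreducible component of `V`: a maximal irreducible exponential subset of `V`. -/
def IsExpComponent {n : ℕ} (K : Subfield ℝ) (T V : Set (Fin n → ℝ)) : Prop :=
  IsIrredExpSet K T ∧ T ⊆ V ∧
    ∀ T', IsIrredExpSet K T' → T ⊆ T' → T' ⊆ V → T' = T

/-- A real algebraic set is irreducible over `K` if it is nonempty and is not the union of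
two proper algebraic subsets over `K`. -/
def IsIrredAlgSet {σ : Type*} (K : Subfield ℝ) (V : Set (σ → ℝ)) : Prop :=
  IsAlgSet K V ∧ V.Nonempty ∧
    ¬ ∃ V₁ V₂ : Set (σ → ℝ),
      IsAlgSet K V₁ ∧ IsAlgSet K V₂ ∧ V = V₁ ∪ V₂ ∧ V₁ ⊂ V ∧ V₂ ⊂ V

/-- `T` is an irreducible component over `K` of the real algebraic set `V`. -/
def IsAlgComponent {σ : Type*} (K : Subfield ℝ) (T V : Set (σ → ℝ)) : Prop :=
  IsIrredAlgSet K T ∧ T ⊆ V ∧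
    ∀ T', IsIrredAlgSet K T' → T ⊆ T' → T' ⊆ V → T' = T

/-- Local (Hausdorff) dimension of `A` at `x`. -/
def locDim {n : ℕ} (A : Set (Fin n → ℝ)) (x : Fin n → ℝ) : ℝ≥0∞ :=
  ⨅ (ε : ℝ) (_ : 0 < ε), dimH (A ∩ Metric.ball x ε)

/-- `A_p`: the set of points of `A` at which `A` has local dimension `p`. -/
def localSet {n : ℕ} (A : Set (Fin n → ℝ)) (p : ℕ) : Set (Fin n → ℝ) :=
  {x | x ∈ A ∧ locDim A x = (p : ℝ≥0∞)}

/-- The exponent vectors of the `U`-monomials of `P` (with nonzero coefficient in `𝕂[X]`). -/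
def Uexps {n : ℕ} (P : MvPolynomial (Fin n ⊕ Fin n) ℝ) : Set (Fin n → ℕ) :=
  (fun (m : (Fin n ⊕ Fin n) →₀ ℕ) (i : Fin n) => m (Sum.inr i)) '' (P.support : Set _)

/-- The union `W_P` of the linear hyperplane sets associated to pairs of distinct
`U`-monomials of `P`. -/
def WP {n : ℕ} (P : MvPolynomial (Fin n ⊕ Fin n) ℝ) : Set (Fin n → ℝ) :=
  {x | ∃ d e : Fin n → ℕ, d ∈ Uexps P ∧ e ∈ Uexps P ∧ d ≠ e ∧
    ∑ i, (d i : ℝ) * x i = ∑ i, (e i : ℝ) * x i}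

/-- Schanuel's conjecture over the reals, with "the transcendence degree of
`ℚ(x₁,…,xₙ,e^{x₁},…,e^{xₙ})` over `ℚ` is less than `n`" expressed as: no `n`-tuple of
elements of `{x₁,…,xₙ,e^{x₁},…,e^{xₙ}}` is algebraically independent over `ℚ`. -/
def SchanuelConjecture : Prop :=
  ∀ (n : ℕ) (x : Fin n → ℝ),
    (¬ ∃ v : Fin n → ℝ,
        (∀ i, v i ∈ Set.range x ∪ Set.range fun j => Real.exp (x j)) ∧
        AlgebraicIndependent ℚ v) →
    ∃ m : Fin n → ℤ, (∃ i, m i ≠ 0) ∧ ∑ i, (m i : ℝ) * x i = 0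


/-- Evaluation of `P ∈ K[X, U]` at `(x, e^x)`, as a ring homomorphism in `P`. -/
def expEvalHom {n : ℕ} (K : Subfield ℝ) (x : Fin n → ℝ) :
    MvPolynomial (Fin n ⊕ Fin n) K →+* ℝ :=
  MvPolynomial.eval₂Hom K.subtype (Sum.elim x fun i => Real.exp (x i))

theorem isExpSet_iff {n : ℕ} {K : Subfield ℝ} {V : Set (Fin n → ℝ)} :
    IsExpSet K V ↔ ∃ Q : MvPolynomial (Fin n ⊕ Fin n) K, V = {x | expEvalHom K x Q = 0} := by
  have key (Q : MvPolynomial (Fin n ⊕ Fin n) K) (x : Fin n → ℝ) :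
      expEval (MvPolynomial.map K.subtype Q) x = expEvalHom K x Q := by
    simp [expEval, expEvalHom, MvPolynomial.eval_map]
  constructor
  · rintro ⟨P, hP, rfl⟩
    obtain ⟨Q, rfl⟩ : P ∈ Set.range (MvPolynomial.map (σ := Fin n ⊕ Fin n) K.subtype) := by
      rw [MvPolynomial.mem_range_map_iff_coeffs_subset]
      intro a ha
      obtain ⟨m, -, rfl⟩ := MvPolynomial.mem_coeffs_iff.mp ha
      exact ⟨⟨_, hP m⟩, rfl⟩
    exact ⟨Q, by simp only [key]⟩
  · rintro ⟨Q, rfl⟩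
    refine ⟨MvPolynomial.map K.subtype Q, fun m => ?_, by simp only [key]⟩
    rw [MvPolynomial.coeff_map]
    exact (Q.coeff m).2

theorem IsExpSet.union {n : ℕ} {K : Subfield ℝ} {V W : Set (Fin n → ℝ)}
    (hV : IsExpSet K V) (hW : IsExpSet K W) : IsExpSet K (V ∪ W) := by
  obtain ⟨P, rfl⟩ := isExpSet_iff.mp hV
  obtain ⟨Q, rfl⟩ := isExpSet_iff.mp hW
  exact isExpSet_iff.mpr ⟨P * Q, by ext x; simp⟩

theorem IsExpSet.inter {n : ℕ} {K : Subfield ℝ} {V W : Set (Fin n → ℝ)}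
    (hV : IsExpSet K V) (hW : IsExpSet K W) : IsExpSet K (V ∩ W) := by
  obtain ⟨P, rfl⟩ := isExpSet_iff.mp hV
  obtain ⟨Q, rfl⟩ := isExpSet_iff.mp hW
  refine isExpSet_iff.mpr ⟨P * P + Q * Q, ?_⟩
  ext x
  simp [mul_self_add_mul_self_eq_zero]

theorem isExpSet_empty {n : ℕ} {K : Subfield ℝ} : IsExpSet K (∅ : Set (Fin n → ℝ)) :=
  isExpSet_iff.mpr ⟨1, by simp⟩

theorem isExpSet_sUnion {n : ℕ} {K : Subfield ℝ} {S : Set (Set (Fin n → ℝ))}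
    (hS : S.Finite) (h : ∀ W ∈ S, IsExpSet K W) : IsExpSet K (⋃₀ S) := by
  induction S, hS using Set.Finite.induction_on with
  | empty => simpa using isExpSet_empty
  | insert _ _ ih =>
    rw [sUnion_insert]
    exact (h _ (mem_insert _ _)).union (ih fun W hW => h W (mem_insert_of_mem _ hW))

/-- The ideal of polynomials over `K` whose E-polynomial vanishes on `V`. -/
def expVanishingIdeal {n : ℕ} (K : Subfield ℝ) (V : Set (Fin n → ℝ)) :
    Ideal (MvPolynomial (Fin n ⊕ Fin n) K) :=
  ⨅ x ∈ V, RingHom.ker (expEvalHom K x)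

theorem mem_expVanishingIdeal {n : ℕ} {K : Subfield ℝ} {V : Set (Fin n → ℝ)}
    {P : MvPolynomial (Fin n ⊕ Fin n) K} :
    P ∈ expVanishingIdeal K V ↔ ∀ x ∈ V, expEvalHom K x P = 0 := by
  simp [expVanishingIdeal, Submodule.mem_iInf, RingHom.mem_ker]

theorem IsExpSet.expVanishingIdeal_lt {n : ℕ} {K : Subfield ℝ} {V W : Set (Fin n → ℝ)}
    (hV : IsExpSet K V) (h : V ⊂ W) : expVanishingIdeal K W < expVanishingIdeal K V := by
  obtain ⟨P, rfl⟩ := isExpSet_iff.mp hV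
  refine SetLike.lt_iff_le_and_exists.mpr ⟨fun Q hQ => ?_, P, ?_, fun hP => h.2 fun x hx => ?_⟩
  · rw [mem_expVanishingIdeal] at hQ ⊢
    exact fun x hx => hQ x (h.1 hx)
  · exact mem_expVanishingIdeal.mpr fun x hx => hx
  · exact mem_expVanishingIdeal.mp hP x hx

/-- Every exponential set is a finite union of irreducible ones (the empty union if empty). -/
theorem IsExpSet.exists_finite_sUnion_irred {n : ℕ} {K : Subfield ℝ} {V : Set (Fin n → ℝ)}
    (hV : IsExpSet K V) :
    ∃ S : Set (Set (Fin n → ℝ)), S.Finite ∧ (∀ W ∈ S, IsIrredExpSet K W) ∧ V = ⋃₀ S := by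
  induction hI : expVanishingIdeal K V using WellFoundedGT.induction generalizing V with
  | _ I ih =>
  subst hI
  rcases V.eq_empty_or_nonempty with rfl | hne
  · exact ⟨∅, by simp⟩
  by_cases hirr : IsIrredExpSet K V
  · exact ⟨{V}, by simpa using hirr⟩
  · simp only [IsIrredExpSet, hV, hne, true_and, not_not] at hirr
    obtain ⟨V₁, V₂, h₁, h₂, hU, hlt₁, hlt₂⟩ := hirr
    obtain ⟨S₁, hf₁, hi₁, e₁⟩ := ih _ (h₁.expVanishingIdeal_lt hlt₁) h₁ rfl
    obtain ⟨S₂, hf₂, hi₂, e₂⟩ := ih _ (h₂.expVanishingIdeal_lt hlt₂) h₂ rfl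
    exact ⟨S₁ ∪ S₂, hf₁.union hf₂, fun W hW => hW.elim (hi₁ W) (hi₂ W),
      by rw [sUnion_union, ← e₁, ← e₂, hU]⟩

theorem IsIrredExpSet.subset_or_subset {n : ℕ} {K : Subfield ℝ} {A B C : Set (Fin n → ℝ)}
    (hA : IsIrredExpSet K A) (hB : IsExpSet K B) (hC : IsExpSet K C) (h : A ⊆ B ∪ C) :
    A ⊆ B ∨ A ⊆ C := by
  by_contra! hn
  refine hA.2.2 ⟨A ∩ B, A ∩ C, hA.1.inter hB, hA.1.inter hC, ?_, ?_, ?_⟩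
  · rw [← inter_union_distrib_left, inter_eq_left.mpr h]
  · exact inter_ssubset_left_iff.mpr hn.1
  · exact inter_ssubset_left_iff.mpr hn.2

theorem IsIrredExpSet.exists_subset_of_subset_sUnion {n : ℕ} {K : Subfield ℝ}
    {A : Set (Fin n → ℝ)} {S : Set (Set (Fin n → ℝ))} (hA : IsIrredExpSet K A)
    (hS : S.Finite) (hexp : ∀ W ∈ S, IsExpSet K W) (h : A ⊆ ⋃₀ S) : ∃ B ∈ S, A ⊆ B := by
  induction S, hS using Set.Finite.induction_on with
  | empty => exact absurd (subset_empty_iff.mp (by simpa using h)) hA.2.1.ne_empty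
  | @insert B S _ hS ih =>
    have hS' : ∀ W ∈ S, IsExpSet K W := fun W hW => hexp W (mem_insert_of_mem _ hW)
    rw [sUnion_insert] at h
    rcases hA.subset_or_subset (hexp B (mem_insert _ _)) (isExpSet_sUnion hS hS') h with h | h
    · exact ⟨B, mem_insert _ _, h⟩
    · obtain ⟨C, hC, hAC⟩ := ih hS' h
      exact ⟨C, mem_insert_of_mem _ hC, hAC⟩

/-- An irredundant finite family of irreducible exponential sets is contained in any other
finite family of irreducible exponential sets with the same union. -/
theorem subset_of_sUnion_eq_of_irred {n : ℕ} {K : Subfield ℝ} {S T : Set (Set (Fin n → ℝ))}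
    (hSf : S.Finite) (hS : ∀ W ∈ S, IsIrredExpSet K W)
    (hSanti : ∀ A ∈ S, ∀ B ∈ S, A ≠ B → ¬ A ⊆ B)
    (hTf : T.Finite) (hT : ∀ W ∈ T, IsIrredExpSet K W) (h : ⋃₀ S = ⋃₀ T) : S ⊆ T := by
  intro A hA
  obtain ⟨B, hB, hAB⟩ := (hS A hA).exists_subset_of_subset_sUnion hTf
    (fun W hW => (hT W hW).1) (h ▸ subset_sUnion_of_mem hA)
  obtain ⟨C, hC, hBC⟩ := (hT B hB).exists_subset_of_subset_sUnion hSf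
    (fun W hW => (hS W hW).1) (h ▸ subset_sUnion_of_mem hB)
  obtain rfl : A = C := by
    by_contra hne
    exact hSanti A hA C hC hne (hAB.trans hBC)
  rwa [hAB.antisymm hBC]

/-- Every nonempty exponential set is a finite union of irreducible exponential sets,
and the decomposition with no containments among the pieces is unique. -/
theorem stmt4 (n : ℕ) (K : Subfield ℝ) (hK : RealAlgExt K)
    (V : Set (Fin n → ℝ)) (hV : IsExpSet K V) (hne : V.Nonempty) :
    (∃ S : Set (Set (Fin n → ℝ)), S.Finite ∧ (∀ W ∈ S, IsIrredExpSet K W) ∧ V = ⋃₀ S ∧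
      (∀ A ∈ S, ∀ B ∈ S, A ≠ B → ¬ A ⊆ B)) ∧
    (∀ S₁ S₂ : Set (Set (Fin n → ℝ)),
      S₁.Finite → (∀ W ∈ S₁, IsIrredExpSet K W) → V = ⋃₀ S₁ →
        (∀ A ∈ S₁, ∀ B ∈ S₁, A ≠ B → ¬ A ⊆ B) →
      S₂.Finite → (∀ W ∈ S₂, IsIrredExpSet K W) → V = ⋃₀ S₂ →
        (∀ A ∈ S₂, ∀ B ∈ S₂, A ≠ B → ¬ A ⊆ B) →
      S₁ = S₂) := by
  refine ⟨?_, fun S₁ S₂ hf₁ hi₁ e₁ ha₁ hf₂ hi₂ e₂ ha₂ => ?_⟩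
  · obtain ⟨S, hf, hi, e⟩ := hV.exists_finite_sUnion_irred
    refine ⟨{A | Maximal (· ∈ S) A}, hf.subset fun A hA => hA.prop,
      fun W hW => hi W hW.prop, ?_, fun A hA B hB hAB hsub => hAB (hA.eq_of_subset hB.prop hsub)⟩
    rw [e]
    refine (sUnion_subset fun A hA => ?_).antisymm (sUnion_subset_sUnion fun A hA => hA.prop)
    obtain ⟨B, hAB, hB⟩ := hf.exists_le_maximal hA
    exact subset_sUnion_of_subset _ B hAB hB
  · exact (subset_of_sUnion_eq_of_irred hf₁ hi₁ ha₁ hf₂ hi₂ (e₁ ▸ e₂)).antisymm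
      (subset_of_sUnion_eq_of_irred hf₂ hi₂ ha₂ hf₁ hi₁ (e₂ ▸ e₁))

end
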